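/- Fix n ≥ 1 and r ≥ 0. Let W be a closed subspace of K with (S x ∈ W for every x ∈ W, where S is the bilateral shift) and K_r ⊆ W ⊆ K_{-r(n-1)}. Then there exists a finitely supported family of matrices (a_j)_{j ∈ ℤ} in Matrix (Fin n) (Fin n) ℂ with a_j = 0 unless -r(n-1) ≤ j ≤ r, such that f(z) := ∑_j a_j z^j is unitary for every z ∈ ℂ with ‖z‖ = 1, such that f(1) = ∑_j a_j is the identity matrix, and such that W = closure(M_f(K₊)). (That is, every element of the bounded Grassmannian Gr^z_{bdd,r} arises from a based polynomial loop in U(n) of degree at most r.) -/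

import Mathlib

noncomputable section

/-- The Hilbert space `K = ℓ²(ℤ, ℂⁿ)`, the model of `L²(S¹) ⊗ ℂⁿ`. -/
abbrev KSpN (n : ℕ) := lp (fun _ : ℤ => EuclideanSpace ℂ (Fin n)) 2

lemma shift_zpow {n : ℕ} (S : KSpN n ≃ₗᵢ[ℂ] KSpN n)
    (hS : ∀ (x : KSpN n) (m : ℤ), (S x) m = x (m - 1)) (k : ℤ) :
    ∀ (x : KSpN n) (m : ℤ), ((S ^ k) x) m = x (m - k) := by
  induction k using Int.induction_on with
  | zero => intro x m; simp
  | succ i ih =>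
    intro x m
    rw [zpow_add_one, LinearIsometryEquiv.coe_mul, Function.comp_apply, ih, hS,
      show m - (i:ℤ) - 1 = m - ((i:ℤ) + 1) by ring]
  | pred i ih =>
    intro x m
    have h : (S ^ (-(i:ℤ))) x = (S ^ (-(i:ℤ) - 1)) (S x) := by
      have : S ^ (-(i:ℤ)) = S ^ (-(i:ℤ) - 1) * S := by
        rw [← zpow_add_one]; congr 1; ring
      rw [this]; rfl
    have h2 : (S ^ (-(i:ℤ) - 1)) x = (S ^ (-(i:ℤ))) (S⁻¹ x) := by
      rw [zpow_sub_one]; rfl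
    rw [h2, ih]
    have h3 := hS (S⁻¹ x) (m - (-(i:ℤ)) + 1)
    have h4 : S (S⁻¹ x) = x := S.apply_symm_apply x
    rw [h4] at h3
    rw [show m - (-(i:ℤ) - 1) = m - (-(i:ℤ)) + 1 by ring, h3,
      show m - (-(i:ℤ)) + 1 - 1 = m - (-(i:ℤ)) by ring]

lemma shift_add {n : ℕ} (S : KSpN n ≃ₗᵢ[ℂ] KSpN n) (k l : ℤ) (x : KSpN n) :
    (S ^ (k + l)) x = (S ^ k) ((S ^ l) x) := by
  rw [zpow_add]; rfl

lemma inner_shift {n : ℕ} (S : KSpN n ≃ₗᵢ[ℂ] KSpN n) (k l : ℤ) (x y : KSpN n) :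
    inner ℂ ((S ^ k) x) ((S ^ l) y) = inner ℂ x ((S ^ (l - k)) y) := by
  have : (S ^ l) y = (S ^ k) ((S ^ (l - k)) y) := by
    rw [← shift_add]; congr 2; ring
  rw [this, LinearIsometryEquiv.inner_map_map]

/-- wandering subspace -/
def wanderE {n : ℕ} (S : KSpN n ≃ₗᵢ[ℂ] KSpN n) (W : Submodule ℂ (KSpN n)) :
    Submodule ℂ (KSpN n) := W ⊓ (W.map (S.toLinearEquiv : KSpN n →ₗ[ℂ] KSpN n))ᗮ

lemma mem_wanderE {n : ℕ} (S : KSpN n ≃ₗᵢ[ℂ] KSpN n) (W : Submodule ℂ (KSpN n)) (v : KSpN n) :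
    v ∈ wanderE S W ↔ v ∈ W ∧ ∀ w ∈ W, inner ℂ (S w) v = 0 := by
  constructor
  · intro h
    exact ⟨h.1, fun w hw => h.2 _ ⟨w, hw, rfl⟩⟩
  · intro h
    refine ⟨h.1, ?_⟩
    rintro _ ⟨w, hw, rfl⟩
    exact h.2 w hw

lemma shift_zpow_mem {n : ℕ} (S : KSpN n ≃ₗᵢ[ℂ] KSpN n) (W : Submodule ℂ (KSpN n))
    (hSW : ∀ x ∈ W, S x ∈ W) (k : ℤ) (hk : 0 ≤ k) (x : KSpN n) (hx : x ∈ W) : (S ^ k) x ∈ W := by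
  lift k to ℕ using hk
  induction k with
  | zero => simpa using hx
  | succ k ih =>
    have : (S ^ ((k + 1 : ℕ) : ℤ)) x = S ((S ^ (k : ℤ)) x) := by
      rw [show ((k + 1 : ℕ) : ℤ) = 1 + k by push_cast; ring, shift_add, zpow_one]
    rw [this]; exact hSW _ ih

lemma wander_orth_pos {n : ℕ} (S : KSpN n ≃ₗᵢ[ℂ] KSpN n) (W : Submodule ℂ (KSpN n))
    (hSW : ∀ x ∈ W, S x ∈ W) (k : ℤ) (hk : 0 < k) (v w : KSpN n) (hv : v ∈ wanderE S W)
    (hw : w ∈ W) : inner ℂ v ((S ^ k) w) = 0 := by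
  have : (S ^ k) w = S ((S ^ (k - 1)) w) := by
    conv_lhs => rw [show k = 1 + (k - 1) by ring, shift_add, zpow_one]
  rw [this]
  exact inner_eq_zero_symm.1 (((mem_wanderE S W v).1 hv).2 _ (shift_zpow_mem S W hSW _ (by lia) _ hw))

lemma wander_orth {n : ℕ} (S : KSpN n ≃ₗᵢ[ℂ] KSpN n) (W : Submodule ℂ (KSpN n))
    (hSW : ∀ x ∈ W, S x ∈ W) (k : ℤ) (hk : k ≠ 0) (v w : KSpN n) (hv : v ∈ wanderE S W)
    (hw : w ∈ wanderE S W) : inner ℂ v ((S ^ k) w) = 0 := by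
  rcases lt_or_gt_of_ne hk with h | h
  · have := inner_shift S (-k) 0 v w
    rw [zero_sub, neg_neg] at this
    rw [← this]
    apply inner_eq_zero_symm.1
    simpa using wander_orth_pos S W hSW (-k) (by lia) w v hw ((mem_wanderE S W v).1 hv).1
  · exact wander_orth_pos S W hSW k h v w hv ((mem_wanderE S W w).1 hw).1

/-- evaluation at z -/
def evalZ (n : ℕ) (lo hi : ℤ) (z : ℂ) : KSpN n →ₗ[ℂ] EuclideanSpace ℂ (Fin n) where
  toFun v := ∑ j ∈ Finset.Icc lo hi, z ^ j • v j
  map_add' x y := by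
    simp [Finset.sum_add_distrib]
  map_smul' c x := by
    simp only [RingHom.id_apply, Finset.smul_sum, lp.coeFn_smul, Pi.smul_apply]
    exact Finset.sum_congr rfl fun j _ => smul_comm _ _ _

lemma evalZ_inner {n : ℕ} (S : KSpN n ≃ₗᵢ[ℂ] KSpN n)
    (hS : ∀ (x : KSpN n) (m : ℤ), (S x) m = x (m - 1)) (lo hi : ℤ) (z : ℂ) (hz : ‖z‖ = 1)
    (v w : KSpN n)
    (hv : ∀ m, m ∉ Finset.Icc lo hi → v m = 0) (hw : ∀ m, m ∉ Finset.Icc lo hi → w m = 0)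
    (h0 : ∀ k : ℤ, k ≠ 0 → inner ℂ v ((S ^ k) w) = 0) :
    inner ℂ (evalZ n lo hi z v) (evalZ n lo hi z w) = inner ℂ v w := by
  have hz0 : z ≠ 0 := by intro h; simp [h] at hz
  have key : ∀ k : ℤ, ∑ j ∈ Finset.Icc lo hi, inner ℂ (v j) (w (j + k))
      = inner ℂ v ((S ^ (-k)) w) := by
    intro k
    rw [lp.inner_eq_tsum, tsum_eq_sum (s := Finset.Icc lo hi)]
    · refine Finset.sum_congr rfl fun j _ => ?_
      rw [shift_zpow S hS, sub_neg_eq_add]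
    · intro m hm; simp [hv m hm]
  have hcz : ∀ j : ℤ, (starRingEnd ℂ) (z ^ j) = z ^ (-j) := by
    intro j
    rw [map_zpow₀, ← Complex.inv_eq_conj hz, inv_zpow, zpow_neg]
  simp only [evalZ, LinearMap.coe_mk, AddHom.coe_mk]
  rw [sum_inner]
  simp only [inner_sum, inner_smul_left, inner_smul_right, hcz]
  have step : ∀ j ∈ Finset.Icc lo hi,
      ∑ j' ∈ Finset.Icc lo hi, z ^ j' * (z ^ (-j) * inner ℂ (v j) (w j'))
      = ∑ k ∈ Finset.Icc (lo - hi) (hi - lo), z ^ k * inner ℂ (v j) (w (j + k)) := by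
    intro j hj
    rw [Finset.mem_Icc] at hj
    have : ∑ k ∈ Finset.Icc (lo - hi) (hi - lo), z ^ k * inner ℂ (v j) (w (j + k))
      = ∑ j' ∈ (Finset.Icc (lo - hi) (hi - lo)).image (fun k => j + k),
          z ^ j' * (z ^ (-j) * inner ℂ (v j) (w j')) := by
      rw [Finset.sum_image (by intro a _ b _ h; simpa using h)]
      refine Finset.sum_congr rfl fun k _ => ?_
      rw [← mul_assoc, ← zpow_add₀ hz0, show j + k + -j = k by ring]
    rw [this]
    apply Finset.sum_subset
    · intro m hm
      rw [Finset.mem_Icc] at hm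
      rw [Finset.mem_image]
      exact ⟨m - j, by rw [Finset.mem_Icc]; lia, by ring⟩
    · intro m _ hm
      simp [hw m hm]
  rw [Finset.sum_congr rfl step, Finset.sum_comm]
  simp only [← Finset.mul_sum, key]
  by_cases hle : lo ≤ hi
  · rw [Finset.sum_eq_single 0]
    · simp
    · intro k _ hk
      rw [h0 (-k) (by simpa using hk), mul_zero]
    · intro h; exact absurd (Finset.mem_Icc.2 ⟨by lia, by lia⟩) h
  · rw [Finset.Icc_eq_empty (by lia), Finset.sum_empty]
    have : v = 0 := by
      ext m : 2
      rw [hv m (by simp; lia)]; rfl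
    simp [this]

lemma exists_wander_decomp {n : ℕ} (S : KSpN n ≃ₗᵢ[ℂ] KSpN n) (W : Submodule ℂ (KSpN n))
    (hWclosed : IsClosed (W : Set (KSpN n)))
    (hSW : ∀ x ∈ W, S x ∈ W) (y : KSpN n) (hy : y ∈ W)
    (h : ∀ v ∈ wanderE S W, inner ℂ v y = 0) : ∃ w ∈ W, S w = y := by
  set V := W.map (S.toLinearEquiv : KSpN n →ₗ[ℂ] KSpN n) with hV
  have hVc : IsClosed (V : Set (KSpN n)) := by
    have : (V : Set (KSpN n)) = S '' (W : Set (KSpN n)) := by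
      simp [hV, Submodule.map_coe]
    rw [this]
    exact S.toHomeomorph.isClosedMap _ hWclosed
  have : CompleteSpace V := hVc.completeSpace_coe
  obtain ⟨p, hp, q, hq, hpq⟩ := Submodule.exists_add_mem_mem_orthogonal (K := V) y
  have hp' := hp
  obtain ⟨w, hw, hwp⟩ := hp
  have hpW : p ∈ W := by rw [← hwp]; exact hSW w hw
  have hqW : q ∈ W := by
    have : q = y - p := by rw [hpq]; abel
    rw [this]; exact W.sub_mem hy hpW
  have hqE : q ∈ wanderE S W := ⟨hqW, hq⟩
  have h1 := h q hqE
  rw [hpq, inner_add_right, inner_eq_zero_symm.1 (hq p hp'), zero_add, inner_self_eq_zero] at h1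
  exact ⟨w, hw, by rw [hpq, h1, add_zero]; exact hwp⟩

lemma wander_factA {n : ℕ} (S : KSpN n ≃ₗᵢ[ℂ] KSpN n)
    (hS : ∀ (x : KSpN n) (m : ℤ), (S x) m = x (m - 1)) (W : Submodule ℂ (KSpN n))
    (hWclosed : IsClosed (W : Set (KSpN n)))
    (hSW : ∀ x ∈ W, S x ∈ W) (lo : ℤ)
    (hhigh : ∀ x : KSpN n, x ∈ W → ∀ m : ℤ, m < lo → x m = 0)
    (x : KSpN n) (hx : x ∈ W)
    (h : ∀ k : ℤ, 0 ≤ k → ∀ v ∈ wanderE S W, inner ℂ ((S ^ k) v) x = 0) : x = 0 := by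
  have key : ∀ k : ℕ, ∃ y ∈ W, (S ^ (k : ℤ)) y = x := by
    intro k
    induction k with
    | zero => exact ⟨x, hx, by simp⟩
    | succ k ih =>
      obtain ⟨y, hy, hyx⟩ := ih
      obtain ⟨w, hw, hwy⟩ := exists_wander_decomp S W hWclosed hSW y hy (by
        intro v hv
        have := h k (by positivity) v hv
        rwa [← hyx, LinearIsometryEquiv.inner_map_map] at this)
      refine ⟨w, hw, ?_⟩
      rw [show ((k + 1 : ℕ) : ℤ) = k + 1 by push_cast; ring, shift_add, zpow_one, hwy, hyx]
  ext m : 2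
  obtain ⟨y, hy, hyx⟩ := key (m - lo + 1).toNat
  rw [← hyx, shift_zpow S hS, hhigh y hy _ (by lia)]; rfl

lemma wander_total {n : ℕ} (S : KSpN n ≃ₗᵢ[ℂ] KSpN n)
    (hS : ∀ (x : KSpN n) (m : ℤ), (S x) m = x (m - 1)) (W : Submodule ℂ (KSpN n))
    (hWclosed : IsClosed (W : Set (KSpN n)))
    (hSW : ∀ x ∈ W, S x ∈ W) (lo hi : ℤ)
    (hlow : ∀ x : KSpN n, (∀ m : ℤ, m < hi → x m = 0) → x ∈ W)
    (hhigh : ∀ x : KSpN n, x ∈ W → ∀ m : ℤ, m < lo → x m = 0)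
    (x : KSpN n)
    (h : ∀ k : ℤ, ∀ v ∈ wanderE S W, inner ℂ ((S ^ k) v) x = 0) : x = 0 := by
  have : CompleteSpace W := hWclosed.completeSpace_coe
  have h2 : ∀ l : ℤ, (S ^ l) x ∈ Wᗮ := by
    intro l
    obtain ⟨p, hp, q, hq, hpq⟩ := Submodule.exists_add_mem_mem_orthogonal (K := W) ((S ^ l) x)
    have : p = 0 := by
      apply wander_factA S hS W hWclosed hSW lo hhigh p hp
      intro k hk v hv
      have h3 : inner ℂ ((S ^ k) v) ((S ^ l) x) = 0 := by
        have : (S ^ k) v = (S ^ l) ((S ^ (k - l)) v) := by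
          rw [← shift_add]; congr 2; ring
        rw [this, LinearIsometryEquiv.inner_map_map]
        exact h _ v hv
      rw [hpq, inner_add_right,
        hq _ (shift_zpow_mem S W hSW k hk v ((mem_wanderE S W v).1 hv).1), add_zero] at h3
      exact h3
    rw [hpq, this, zero_add]; exact hq
  ext m : 2
  have h4 : inner ℂ (lp.single (E := fun _ : ℤ => EuclideanSpace ℂ (Fin n)) 2 hi (x m))
      ((S ^ (hi - m)) x) = 0 := by
    apply h2
    apply hlow
    intro j hj
    rw [lp.single_apply, Pi.single_eq_of_ne (by lia)]
  rw [lp.inner_single_left, shift_zpow S hS, show hi - (hi - m) = m by ring,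
    inner_self_eq_zero] at h4
  rw [h4]; rfl

lemma wander_supp {n : ℕ} (S : KSpN n ≃ₗᵢ[ℂ] KSpN n)
    (hS : ∀ (x : KSpN n) (m : ℤ), (S x) m = x (m - 1)) (W : Submodule ℂ (KSpN n))
    (lo hi : ℤ)
    (hlow : ∀ x : KSpN n, (∀ m : ℤ, m < hi → x m = 0) → x ∈ W)
    (hhigh : ∀ x : KSpN n, x ∈ W → ∀ m : ℤ, m < lo → x m = 0)
    (v : KSpN n) (hv : v ∈ wanderE S W) (m : ℤ) (hm : m ∉ Finset.Icc lo hi) : v m = 0 := by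
  rw [mem_wanderE] at hv
  by_cases h : m < lo
  · exact hhigh v hv.1 m h
  · have hm : hi < m := by
      rw [Finset.mem_Icc] at hm; lia
    have h1 := hv.2 (lp.single (E := fun _ : ℤ => EuclideanSpace ℂ (Fin n)) 2 (m - 1) (v m)) (by
      apply hlow
      intro j hj
      rw [lp.single_apply, Pi.single_eq_of_ne (by lia)])
    have h2 : S (lp.single (E := fun _ : ℤ => EuclideanSpace ℂ (Fin n)) 2 (m - 1) (v m))
        = lp.single (E := fun _ : ℤ => EuclideanSpace ℂ (Fin n)) 2 m (v m) := by
      ext j : 2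
      rw [hS, lp.single_apply, lp.single_apply]
      by_cases hj : j = m
      · subst hj; simp
      · rw [Pi.single_eq_of_ne hj, Pi.single_eq_of_ne (by lia)]
    rwa [h2, lp.inner_single_left, inner_self_eq_zero] at h1

lemma wander_orthonormal {n : ℕ} (S : KSpN n ≃ₗᵢ[ℂ] KSpN n) (W : Submodule ℂ (KSpN n))
    (hSW : ∀ x ∈ W, S x ∈ W) {d : ℕ} (e : OrthonormalBasis (Fin d) ℂ (wanderE S W)) :
    Orthonormal ℂ (fun p : Fin d × ℤ => (S ^ p.2) (e p.1 : KSpN n)) := by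
  classical
  rw [orthonormal_iff_ite]
  rintro ⟨i, k⟩ ⟨j, l⟩
  simp only
  rw [inner_shift]
  by_cases hkl : k = l
  · subst hkl
    have := orthonormal_iff_ite.1 e.orthonormal i j
    rw [sub_self, zpow_zero]
    simpa [Submodule.coe_inner] using this
  · rw [wander_orth S W hSW _ (by lia) _ _ (e i).2 (e j).2, if_neg]
    intro h; exact hkl (Prod.ext_iff.1 h).2

/-- the Hilbert basis -/
lemma wander_basis {n : ℕ} (S : KSpN n ≃ₗᵢ[ℂ] KSpN n)
    (hS : ∀ (x : KSpN n) (m : ℤ), (S x) m = x (m - 1)) (W : Submodule ℂ (KSpN n))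
    (hWclosed : IsClosed (W : Set (KSpN n)))
    (hSW : ∀ x ∈ W, S x ∈ W) (lo hi : ℤ)
    (hlow : ∀ x : KSpN n, (∀ m : ℤ, m < hi → x m = 0) → x ∈ W)
    (hhigh : ∀ x : KSpN n, x ∈ W → ∀ m : ℤ, m < lo → x m = 0)
    {d : ℕ} (e : OrthonormalBasis (Fin d) ℂ (wanderE S W)) :
    ∃ b : HilbertBasis (Fin d × ℤ) ℂ (KSpN n), ∀ p, b p = (S ^ p.2) (e p.1 : KSpN n) := by
  refine ⟨HilbertBasis.mkOfOrthogonalEqBot (wander_orthonormal S W hSW e) ?_, fun p => by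
    rw [HilbertBasis.coe_mkOfOrthogonalEqBot]⟩
  rw [eq_bot_iff]
  intro x hx
  rw [Submodule.mem_bot]
  apply wander_total S hS W hWclosed hSW lo hi hlow hhigh
  intro k v hv
  have h1 : (⟨v, hv⟩ : wanderE S W) = ∑ i, e.repr ⟨v, hv⟩ i • e i := (e.sum_repr _).symm
  have h2 : v = ∑ i, e.repr ⟨v, hv⟩ i • (e i : KSpN n) := by
    have := congrArg (fun t : wanderE S W => (t : KSpN n)) h1
    simpa using this
  rw [h2, map_sum, sum_inner]
  refine Finset.sum_eq_zero fun i _ => ?_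
  rw [map_smul, inner_smul_left]
  have : inner ℂ ((S ^ k) (e i : KSpN n)) x = 0 :=
    hx _ (Submodule.subset_span ⟨(i, k), rfl⟩)
  rw [this, mul_zero]

lemma wander_dim {n : ℕ} (S : KSpN n ≃ₗᵢ[ℂ] KSpN n)
    (hS : ∀ (x : KSpN n) (m : ℤ), (S x) m = x (m - 1)) (W : Submodule ℂ (KSpN n))
    {d : ℕ} (e : OrthonormalBasis (Fin d) ℂ (wanderE S W))
    (b : HilbertBasis (Fin d × ℤ) ℂ (KSpN n)) (hb : ∀ p, b p = (S ^ p.2) (e p.1 : KSpN n)) :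
    d = n := by
  have h1 : ∀ l : Fin n, HasSum (fun p : Fin d × ℤ =>
      inner ℂ (((e p.1 : KSpN n) (-p.2)) l) (((e p.1 : KSpN n) (-p.2)) l)) (1 : ℂ) := by
    intro l
    have h := b.hasSum_inner_mul_inner
      (lp.single (E := fun _ : ℤ => EuclideanSpace ℂ (Fin n)) 2 0 (EuclideanSpace.single l 1))
      (lp.single (E := fun _ : ℤ => EuclideanSpace ℂ (Fin n)) 2 0 (EuclideanSpace.single l 1))
    simp only [hb, lp.inner_single_left, lp.inner_single_right, shift_zpow S hS,
      lp.single_apply, zero_sub] at h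
    have hA : ∀ v : EuclideanSpace ℂ (Fin n), inner ℂ (EuclideanSpace.single l (1:ℂ)) v *
        inner ℂ v (EuclideanSpace.single l (1:ℂ)) = inner ℂ (v l) (v l) := by
      intro v
      simp [EuclideanSpace.inner_single_left, EuclideanSpace.inner_single_right,
        Complex.mul_conj']
    have hB : inner ℂ (EuclideanSpace.single l (1:ℂ)) (EuclideanSpace.single l (1:ℂ))
      = (1 : ℂ) := by simp
    rw [Pi.single_eq_same] at h
    have hfun : (fun p : Fin d × ℤ =>
        inner ℂ (((e p.1 : KSpN n) (-p.2)) l) (((e p.1 : KSpN n) (-p.2)) l))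
        = (fun p : Fin d × ℤ =>
        inner ℂ (EuclideanSpace.single l (1:ℂ)) ((e p.1 : KSpN n) (-p.2)) *
        inner ℂ ((e p.1 : KSpN n) (-p.2)) (EuclideanSpace.single l (1:ℂ))) := by
      funext p
      exact (hA ((e p.1 : KSpN n) (-p.2))).symm
    rw [hfun]
    have h5 := h
    rw [hB] at h5
    exact h5
  have h2 := hasSum_sum (s := Finset.univ) fun l _ => h1 l
  have h3 := h2.prod_fiberwise (g := fun _ => (1 : ℂ)) (by
    intro i
    have h := lp.hasSum_inner (𝕜 := ℂ) (e i : KSpN n) (e i : KSpN n)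
    rw [← Submodule.coe_inner, (orthonormal_iff_ite.1 e.orthonormal i i), if_pos rfl] at h
    have h' := (Equiv.neg ℤ).hasSum_iff.2 h
    have hfun : (fun k : ℤ => ∑ l,
        inner ℂ (((e i : KSpN n) (-k)) l) (((e i : KSpN n) (-k)) l))
        = (fun k : ℤ => inner ℂ ((e i : KSpN n) (-k)) ((e i : KSpN n) (-k))) := by
      funext k
      exact (PiLp.inner_apply ((e i : KSpN n) (-k)) ((e i : KSpN n) (-k))).symm
    change HasSum (fun k : ℤ => ∑ l,
        inner ℂ (((e i : KSpN n) (-k)) l) (((e i : KSpN n) (-k)) l)) 1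
    rw [hfun]
    exact h')
  have h4 := h3.unique (hasSum_fintype _)
  simp at h4
  exact_mod_cast h4.symm

lemma mem_of_hasSum_closed {n : ℕ} {ι : Type*} (V : Submodule ℂ (KSpN n))
    (hV : IsClosed (V : Set (KSpN n))) (f : ι → KSpN n) (x : KSpN n) (h : HasSum f x)
    (hf : ∀ i, f i ∈ V) : x ∈ V :=
  hV.mem_of_tendsto h (Filter.Eventually.of_forall fun _ => V.sum_mem fun i _ => hf i)

lemma exists_wander_basis {n : ℕ} (S : KSpN n ≃ₗᵢ[ℂ] KSpN n)
    (hS : ∀ (x : KSpN n) (m : ℤ), (S x) m = x (m - 1)) (W : Submodule ℂ (KSpN n))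
    (hWclosed : IsClosed (W : Set (KSpN n)))
    (hSW : ∀ x ∈ W, S x ∈ W) (lo hi : ℤ)
    (hlow : ∀ x : KSpN n, (∀ m : ℤ, m < hi → x m = 0) → x ∈ W)
    (hhigh : ∀ x : KSpN n, x ∈ W → ∀ m : ℤ, m < lo → x m = 0) :
    ∃ e : OrthonormalBasis (Fin n) ℂ (wanderE S W),
      ∀ i, evalZ n lo hi 1 (e i : KSpN n) = EuclideanSpace.single i 1 := by
  let F : wanderE S W →ₗᵢ[ℂ] EuclideanSpace ℂ (Fin n) :=
    ((evalZ n lo hi 1).comp (wanderE S W).subtype).isometryOfInner (by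
      intro v w
      exact evalZ_inner S hS lo hi 1 (by simp) v w
        (wander_supp S hS W lo hi hlow hhigh v v.2) (wander_supp S hS W lo hi hlow hhigh w w.2)
        (fun k hk => wander_orth S W hSW k hk v w v.2 w.2))
  have hfin : FiniteDimensional ℂ (wanderE S W) :=
    FiniteDimensional.of_injective F.toLinearMap F.injective
  let e0 := stdOrthonormalBasis ℂ (wanderE S W)
  obtain ⟨b, hb⟩ := wander_basis S hS W hWclosed hSW lo hi hlow hhigh e0
  have hd := wander_dim S hS W e0 b hb
  let Fe := F.toLinearIsometryEquiv (by rw [hd]; simp)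
  refine ⟨(EuclideanSpace.basisFun (Fin n) ℂ).map Fe.symm, fun i => ?_⟩
  have h : Fe (Fe.symm (EuclideanSpace.single i 1)) = EuclideanSpace.single i 1 :=
    Fe.apply_symm_apply _
  rw [OrthonormalBasis.map_apply, EuclideanSpace.basisFun_apply]
  exact h

theorem wander_main
    (n : ℕ) (lo hi : ℤ)
    (S : KSpN n ≃ₗᵢ[ℂ] KSpN n) (hS : ∀ (x : KSpN n) (m : ℤ), (S x) m = x (m - 1))
    (W : Submodule ℂ (KSpN n)) (hWclosed : IsClosed (W : Set (KSpN n)))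
    (hSW : ∀ x ∈ W, S x ∈ W)
    (hlow : ∀ x : KSpN n, (∀ m : ℤ, m < hi → x m = 0) → x ∈ W)
    (hhigh : ∀ x : KSpN n, x ∈ W → ∀ m : ℤ, m < lo → x m = 0) :
    ∃ a : ℤ → Matrix (Fin n) (Fin n) ℂ,
      (∀ j : ℤ, a j ≠ 0 → (lo ≤ j ∧ j ≤ hi)) ∧
      (∀ z : ℂ, ‖z‖ = 1 →
        (∑ j ∈ Finset.Icc lo hi, z ^ j • a j) ∈ Matrix.unitaryGroup (Fin n) ℂ) ∧
      (∑ j ∈ Finset.Icc lo hi, a j = 1) ∧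
      (∀ Mf : KSpN n → KSpN n,
        (∀ (x : KSpN n) (m : ℤ), Mf x m =
          ∑ j ∈ Finset.Icc lo hi, (a j).mulVec (x (m - j))) →
        (W : Set (KSpN n)) = closure (Mf '' {x : KSpN n | ∀ m : ℤ, m < 0 → x m = 0})) := by
  obtain ⟨e, he⟩ := exists_wander_basis S hS W hWclosed hSW lo hi hlow hhigh
  obtain ⟨b, hb⟩ := wander_basis S hS W hWclosed hSW lo hi hlow hhigh e
  have hsupp : ∀ i m, m ∉ Finset.Icc lo hi → (e i : KSpN n) m = 0 := fun i m hm =>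
    wander_supp S hS W lo hi hlow hhigh (e i) (e i).2 m hm
  let a : ℤ → Matrix (Fin n) (Fin n) ℂ := fun j => Matrix.of fun p i => (e i : KSpN n) j p
  have ha0 : ∀ j, j ∉ Finset.Icc lo hi → a j = 0 := by
    intro j hj
    ext p i
    simp only [a, Matrix.of_apply]
    rw [hsupp i j hj]; rfl
  have haz : ∀ (z : ℂ) (p i : Fin n), (∑ j ∈ Finset.Icc lo hi, z ^ j • a j) p i
      = (evalZ n lo hi z (e i : KSpN n)) p := by
    intro z p i
    simp [evalZ, Matrix.sum_apply, a]
  have hek : ∀ p : Fin n × ℤ, 0 ≤ p.2 → b p ∈ W := by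
    intro p hp
    rw [hb]
    exact shift_zpow_mem S W hSW _ hp _ ((mem_wanderE S W _).1 (e p.1).2).1
  refine ⟨a, ?_, ?_, ?_, ?_⟩
  · intro j hj
    by_contra h
    exact hj (ha0 j (by rwa [Finset.mem_Icc]))
  · intro z hz
    rw [Matrix.mem_unitaryGroup_iff']
    ext i i'
    rw [Matrix.mul_apply]
    simp only [Matrix.star_apply, haz]
    have h := evalZ_inner S hS lo hi z hz (e i) (e i') (hsupp i) (hsupp i')
      (fun k hk => wander_orth S W hSW k hk _ _ (e i).2 (e i').2)
    rw [← Submodule.coe_inner, orthonormal_iff_ite.1 e.orthonormal i i', PiLp.inner_apply] at h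
    rw [Matrix.one_apply, ← h]
    refine Finset.sum_congr rfl fun p _ => ?_
    simp [mul_comm]
  · ext p i
    have h := haz 1 p i
    simp only [one_zpow, one_smul] at h
    rw [h, he, Matrix.one_apply]
    simp [Pi.single_apply]
  · intro Mf hMf
    have hext : ∀ x y : KSpN n, (∀ m p, x m p = y m p) → x = y := by
      intro x y h
      ext m p
      exact h m p
    have hMf' : ∀ (x : KSpN n) (m : ℤ) (p : Fin n), Mf x m p =
        ∑ j ∈ Finset.Icc lo hi, ∑ i, (e i : KSpN n) j p * x (m - j) i := by
      intro x m p
      have := congrFun (hMf x m) p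
      rw [this, Finset.sum_apply]
      rfl
    let L : KSpN n →ₗ[ℂ] KSpN n :=
      { toFun := Mf
        map_add' := by
          intro x y
          apply hext
          intro m p
          have h1 : (Mf x + Mf y) m p = Mf x m p + Mf y m p := rfl
          rw [h1, hMf', hMf', hMf', ← Finset.sum_add_distrib]
          refine Finset.sum_congr rfl fun j _ => ?_
          rw [← Finset.sum_add_distrib]
          refine Finset.sum_congr rfl fun i _ => ?_
          exact mul_add _ _ _
        map_smul' := by
          intro c x
          apply hext
          intro m p
          have h1 : (c • Mf x) m p = c * Mf x m p := rfl
          rw [RingHom.id_apply, h1, hMf', hMf', Finset.mul_sum]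
          refine Finset.sum_congr rfl fun j _ => ?_
          rw [Finset.mul_sum]
          refine Finset.sum_congr rfl fun i _ => ?_
          exact mul_left_comm _ _ _ }
    have hL : ∀ x, L x = Mf x := fun _ => rfl
    have hsingle : ∀ (k : ℤ) (v : EuclideanSpace ℂ (Fin n)),
        L (lp.single (E := fun _ : ℤ => EuclideanSpace ℂ (Fin n)) 2 k v)
          = ∑ i, v i • b (i, k) := by
      intro k v
      apply hext
      intro m p
      have h1 : (∑ i, v i • b (i, k)) m p = ∑ i, v i * (e i : KSpN n) (m - k) p := by
        rw [lp.coeFn_sum, Finset.sum_apply, WithLp.ofLp_sum, Finset.sum_apply]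
        refine Finset.sum_congr rfl fun i _ => ?_
        rw [hb]
        have : (v i • (S ^ k) (e i : KSpN n)) m p = v i * ((S ^ k) (e i : KSpN n)) m p := rfl
        rw [this, shift_zpow S hS]
      rw [h1, hL, hMf', Finset.sum_eq_single (m - k)]
      · refine Finset.sum_congr rfl fun i _ => ?_
        rw [lp.single_apply, show m - (m - k) = k by ring, Pi.single_eq_same, mul_comm]
      · intro j _ hj
        refine Finset.sum_eq_zero fun i _ => ?_
        rw [lp.single_apply, Pi.single_eq_of_ne (by lia)]
        exact mul_zero _
      · intro h
        refine Finset.sum_eq_zero fun i _ => ?_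
        rw [hsupp i _ h]
        exact zero_mul _
    let Kp : Submodule ℂ (KSpN n) :=
      { carrier := {x : KSpN n | ∀ m : ℤ, m < 0 → x m = 0}
        zero_mem' := fun m _ => rfl
        add_mem' := by
          intro x y hx hy m hm
          rw [lp.coeFn_add, Pi.add_apply, hx m hm, hy m hm, add_zero]
        smul_mem' := by
          intro c x hx m hm
          rw [lp.coeFn_smul, Pi.smul_apply, hx m hm, smul_zero] }
    apply Set.Subset.antisymm
    · intro w hw
      have : w ∈ (Kp.map L).topologicalClosure := by
        apply mem_of_hasSum_closed _ (Submodule.isClosed_topologicalClosure _) _ _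
          (b.hasSum_repr w)
        rintro ⟨i, k⟩
        by_cases hk : 0 ≤ k
        · apply Submodule.smul_mem
          apply Submodule.le_topologicalClosure
          refine ⟨lp.single (E := fun _ : ℤ => EuclideanSpace ℂ (Fin n)) 2 k
            (EuclideanSpace.single i 1), ?_, ?_⟩
          · intro m hm
            rw [lp.single_apply, Pi.single_eq_of_ne (by lia)]
          · rw [hsingle, Finset.sum_eq_single i]
            · simp
            · intro j _ hj
              simp [hj]
            · simp
        · have h0 : (b.repr w) (i, k) = 0 := by
            rw [b.repr_apply_apply, hb]
            have h := inner_shift S k 0 (e i : KSpN n) w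
            rw [wander_orth_pos S W hSW (0 - k) (by lia) _ _ (e i).2 hw] at h
            simpa using h
          rw [h0, zero_smul]
          exact Submodule.zero_mem _
      exact this
    · apply closure_minimal _ hWclosed
      rintro _ ⟨x, hx, rfl⟩
      apply mem_of_hasSum_closed _ hWclosed _ _ (b.hasSum_repr (Mf x))
      rintro ⟨i, k⟩
      by_cases hk : 0 ≤ k
      · exact Submodule.smul_mem _ _ (hek _ hk)
      · let N := k + hi - lo
        let x' : KSpN n := ∑ l ∈ Finset.Icc 0 N,
          lp.single (E := fun _ : ℤ => EuclideanSpace ℂ (Fin n)) 2 l (x l)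
        have hx' : ∀ t, t ≤ N → x' t = x t := by
          intro t ht
          simp only [x']
          rw [lp.coeFn_sum, Finset.sum_apply]
          by_cases h0 : t < 0
          · rw [hx t h0]
            refine Finset.sum_eq_zero fun l hl => ?_
            rw [Finset.mem_Icc] at hl
            rw [lp.single_apply, Pi.single_eq_of_ne (by lia)]
          · rw [Finset.sum_eq_single t]
            · rw [lp.single_apply, Pi.single_eq_same]
            · intro l _ hl
              rw [lp.single_apply, Pi.single_eq_of_ne (by lia)]
            · intro h
              exact absurd (Finset.mem_Icc.2 ⟨by lia, ht⟩) h
        have h1 : inner ℂ (b (i, k)) (Mf x) = inner ℂ (b (i, k)) (L x') := by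
          rw [lp.inner_eq_tsum, lp.inner_eq_tsum]
          refine tsum_congr fun m => ?_
          rw [hb, shift_zpow S hS]
          by_cases hm : m - k ∈ Finset.Icc lo hi
          · have : Mf x m = (L x') m := by
              ext p
              rw [hL, hMf', hMf']
              refine Finset.sum_congr rfl fun j hj => ?_
              rw [Finset.mem_Icc] at hm hj
              rw [hx' (m - j) (by simp only [N]; lia)]
            rw [this]
          · simp only [hsupp i _ hm, inner_zero_left]
        have h0 : (b.repr (Mf x)) (i, k) = 0 := by
          rw [b.repr_apply_apply, h1]
          simp only [x']
          rw [map_sum, inner_sum]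
          refine Finset.sum_eq_zero fun l hl => ?_
          rw [Finset.mem_Icc] at hl
          rw [hsingle, inner_sum]
          refine Finset.sum_eq_zero fun i' _ => ?_
          rw [inner_smul_right, b.orthonormal.2, mul_zero]
          intro h
          have := (Prod.ext_iff.1 h).2
          simp only at this
          lia
        rw [h0, zero_smul]
        exact Submodule.zero_mem _

/-- Every closed shift-invariant subspace `W` of `K = ℓ²(ℤ, ℂⁿ)` with
`K_r ⊆ W ⊆ K_{-r(n-1)}` arises as `W = closure (M_f K₊)` for a based polynomial loop
`f(z) = ∑_{j=-r(n-1)}^{r} a_j z^j` in `U(n)` of degree at most `r` with `f(1) = 1`. -/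
theorem exists_poly_loop_of_mem_bounded_grassmannian
    (n : ℕ) (hn : 1 ≤ n) (r : ℕ)
    (S : KSpN n ≃ₗᵢ[ℂ] KSpN n) (hS : ∀ (x : KSpN n) (m : ℤ), (S x) m = x (m - 1))
    (W : Submodule ℂ (KSpN n)) (hWclosed : IsClosed (W : Set (KSpN n)))
    (hSW : ∀ x ∈ W, S x ∈ W)
    (hlow : ∀ x : KSpN n, (∀ m : ℤ, m < (r : ℤ) → x m = 0) → x ∈ W)
    (hhigh : ∀ x : KSpN n, x ∈ W → ∀ m : ℤ, m < -(r : ℤ) * ((n : ℤ) - 1) → x m = 0) :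
    ∃ a : ℤ → Matrix (Fin n) (Fin n) ℂ,
      (∀ j : ℤ, a j ≠ 0 → (-(r : ℤ) * ((n : ℤ) - 1) ≤ j ∧ j ≤ (r : ℤ))) ∧
      (∀ z : ℂ, ‖z‖ = 1 →
        (∑ j ∈ Finset.Icc (-(r : ℤ) * ((n : ℤ) - 1)) (r : ℤ), z ^ j • a j)
          ∈ Matrix.unitaryGroup (Fin n) ℂ) ∧
      (∑ j ∈ Finset.Icc (-(r : ℤ) * ((n : ℤ) - 1)) (r : ℤ), a j = 1) ∧
      (∀ Mf : KSpN n → KSpN n,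
        (∀ (x : KSpN n) (m : ℤ), Mf x m =
          ∑ j ∈ Finset.Icc (-(r : ℤ) * ((n : ℤ) - 1)) (r : ℤ), (a j).mulVec (x (m - j))) →
        (W : Set (KSpN n)) = closure (Mf '' {x : KSpN n | ∀ m : ℤ, m < 0 → x m = 0})) := by
  exact wander_main n _ _ S hS W hWclosed hSW hlow hhigh

end
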